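/- arXiv:2305.01130 — 2 statements merged into one kernel-verified Lean document; each statement's English description precedes it below -/
import Mathlib

section
/- Let L be a totally real number field of degree n, with Σ its set of real embeddings, let V be a complex vector space with dim_ℂ V = n, let Λ ⊂ V be a lattice, and let θ : O_L → End_ℂ(V) be a ring homomorphism with θ(1) = id_V and θ(x)(Λ) ⊆ Λ for every x ∈ O_L. Then there exist z = (z_σ)_{σ∈Σ} ∈ ℂ^Σ with Im(z_σ) > 0 for every σ ∈ Σ, a nonzero fractional ideal 𝔅 of O_L, and a ℂ-linear isomorphism φ : V → ℂ^Σ such that φ(Λ) = { (σ(a)·z_σ + σ(b))_{σ∈Σ} : a ∈ O_L, b ∈ 𝔅 }. -/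
/-!
STATEMENT 10: Let L be a totally real number field of degree n with Σ its set of real
embeddings, V a complex vector space with dim_ℂ V = n, Λ ⊂ V a lattice, and
θ : O_L → End_ℂ(V) a ring homomorphism with θ(1) = id and θ(x)(Λ) ⊆ Λ for all x ∈ O_L.
Then there exist z = (z_σ) ∈ ℂ^Σ with Im(z_σ) > 0 for all σ, a nonzero fractional ideal 𝔅
of O_L, and a ℂ-linear isomorphism φ : V → ℂ^Σ with
φ(Λ) = {(σ(a)·z_σ + σ(b))_σ : a ∈ O_L, b ∈ 𝔅}.
-/

open NumberField

/-- A lattice in a finite-dimensional complex vector space: a finitely generated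
ℤ-submodule, free of rank `2·dim_ℂ V`, spanning `V` over ℝ. -/
def IsLattice (V : Type*) [AddCommGroup V] [Module ℂ V] (Λ : Submodule ℤ V) : Prop :=
  Λ.FG ∧ Module.finrank ℤ Λ = 2 * Module.finrank ℂ V ∧ Submodule.span ℝ (Λ : Set V) = ⊤

section Steinitz

open Module nonZeroDivisors

variable {R K W : Type*} [CommRing R] [Field K] [Algebra R K] [IsFractionRing R K]
  [AddCommGroup W] [Module K W] [Module R W] [IsScalarTower R K W]

/-- Denominators can be cleared in the `K`-span of an `R`-module. -/
lemma exists_smul_mem_of_mem_span [IsDomain R] (Λ : Submodule R W) {w : W}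
    (hw : w ∈ Submodule.span K (Λ : Set W)) : ∃ r : R, r ≠ 0 ∧ r • w ∈ Λ := by
  induction hw using Submodule.span_induction with
  | mem x hx => exact ⟨1, one_ne_zero, by simpa using hx⟩
  | zero => exact ⟨1, one_ne_zero, by simp⟩
  | add x y _ _ hx hy =>
    obtain ⟨r, hr, hrx⟩ := hx
    obtain ⟨s, hs, hsy⟩ := hy
    refine ⟨r * s, mul_ne_zero hr hs, ?_⟩
    rw [smul_add]
    refine Λ.add_mem ?_ ?_
    · rw [mul_comm, mul_smul]; exact Λ.smul_mem _ hrx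
    · rw [mul_smul]; exact Λ.smul_mem _ hsy
  | smul c x _ hx =>
    obtain ⟨r, hr, hrx⟩ := hx
    obtain ⟨p, q, hq, rfl⟩ := IsFractionRing.div_surjective (A := R) c
    have hq0 : algebraMap R K q ≠ 0 :=
      IsFractionRing.to_map_ne_zero_of_mem_nonZeroDivisors hq
    refine ⟨q * r, mul_ne_zero (nonZeroDivisors.ne_zero hq) hr, ?_⟩
    have : (q * r) • (algebraMap R K p / algebraMap R K q) • x = p • r • x := by
      rw [← algebraMap_smul K (q * r), ← algebraMap_smul K p, ← algebraMap_smul K r x, smul_smul,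
        smul_smul, map_mul]
      congr 1
      field_simp
    rw [this]
    exact Λ.smul_mem _ hrx

/-- The fractional ideal of values of a functional on a finitely generated module. -/
lemma exists_fractionalIdeal_mem_iff_apply [IsDomain R] [IsNoetherianRing R] (f : W →ₗ[K] K)
    (Λ : Submodule R W) (hfg : Λ.FG) :
    ∃ A : FractionalIdeal R⁰ K, ∀ a, a ∈ A ↔ ∃ v ∈ Λ, f v = a :=
  ⟨⟨Λ.map (f.restrictScalars R), FractionalIdeal.isFractional_of_fg (hfg.map _)⟩,
    fun _ => Iff.rfl⟩

/-- The fractional ideal of scalars moving a nonzero vector into a finitely generated module. -/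
lemma exists_fractionalIdeal_mem_iff_smul_mem [IsDomain R] [IsNoetherianRing R] {u : W} (hu : u ≠ 0)
    (Λ : Submodule R W) (hfg : Λ.FG) :
    ∃ B : FractionalIdeal R⁰ K, ∀ b : K, b ∈ B ↔ b • u ∈ Λ := by
  let m : K →ₗ[R] W := (LinearMap.toSpanSingleton K W u).restrictScalars R
  have hm : Function.Injective m := smul_left_injective K hu
  have := isNoetherian_of_fg_of_noetherian Λ hfg
  have hB : (Λ.comap m).FG := by
    refine Submodule.fg_of_fg_map_injective m hm ?_
    exact (isNoetherian_submodule.mp this) _ (Submodule.map_comap_le m Λ)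
  exact ⟨⟨_, FractionalIdeal.isFractional_of_fg hB⟩,
    fun _ => Iff.rfl⟩

/-- A functional on a rank two module over a Dedekind domain splits it. -/
lemma exists_split_of_functional [IsDedekindDomain R] (hW : finrank K W = 2)
    (Λ : Submodule R W) (hfg : Λ.FG) (hspan : Submodule.span K (Λ : Set W) = ⊤)
    (f : W →ₗ[K] K) (hf : f ≠ 0) :
    ∃ (w u : W) (A B : FractionalIdeal R⁰ K), f w = 1 ∧ f u = 0 ∧ u ≠ 0 ∧ A ≠ 0 ∧ B ≠ 0 ∧
      (∀ a, a ∈ A ↔ ∃ v ∈ Λ, f v = a) ∧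
      ∀ v, v ∈ Λ ↔ ∃ a ∈ A, ∃ b ∈ B, v = a • w + b • u := by
  have : FiniteDimensional K W := .of_finrank_pos (by omega)
  have hker : finrank K (LinearMap.ker f) = 1 := by
    have h1 := f.finrank_range_add_finrank_ker
    rw [LinearMap.range_eq_top.mpr (LinearMap.surjective hf), finrank_top, finrank_self, hW] at h1
    omega
  obtain ⟨⟨u, hfu⟩, hu0, hu⟩ := finrank_eq_one_iff'.mp hker
  replace hu0 : u ≠ 0 := fun h => hu0 (by simp [h])
  rw [LinearMap.mem_ker] at hfu
  have clear : ∀ w : W, ∃ r : R, r ≠ 0 ∧ r • w ∈ Λ := fun w =>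
    exists_smul_mem_of_mem_span (K := K) Λ (by simp [hspan])
  obtain ⟨A, hA⟩ := exists_fractionalIdeal_mem_iff_apply f Λ hfg
  obtain ⟨B, hB⟩ := exists_fractionalIdeal_mem_iff_smul_mem (K := K) hu0 Λ hfg
  have hA0 : A ≠ 0 := by
    obtain ⟨w, hw⟩ := LinearMap.surjective hf 1
    obtain ⟨r, hr, hrw⟩ := clear w
    rintro rfl
    have h := (hA (algebraMap R K r)).mpr ⟨_, hrw, by
      rw [← algebraMap_smul K r w, map_smul, hw, smul_eq_mul, mul_one]⟩
    rw [FractionalIdeal.mem_zero_iff] at h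
    exact hr ((FaithfulSMul.algebraMap_eq_zero_iff R K).mp h)
  have hB0 : B ≠ 0 := by
    obtain ⟨r, hr, hru⟩ := clear u
    rintro rfl
    have h := (hB (algebraMap R K r)).mpr (by rwa [algebraMap_smul])
    rw [FractionalIdeal.mem_zero_iff] at h
    exact hr ((FaithfulSMul.algebraMap_eq_zero_iff R K).mp h)
  have key : ∀ c ∈ A * A⁻¹, ∃ w, f w = c ∧ ∀ a ∈ A, a • w ∈ Λ := by
    intro c hc
    refine FractionalIdeal.mul_induction_on hc ?_ ?_
    · intro i hi j hj
      obtain ⟨v, hv, rfl⟩ := (hA i).mp hi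
      refine ⟨j • v, by simp [mul_comm], fun a ha => ?_⟩
      have h := (FractionalIdeal.mem_inv_iff hA0).mp hj a ha
      obtain ⟨r, hr⟩ := (FractionalIdeal.mem_one_iff _).mp h
      rw [smul_smul, mul_comm, ← hr, algebraMap_smul]
      exact Λ.smul_mem _ hv
    · rintro x y ⟨w, rfl, hw⟩ ⟨w', rfl, hw'⟩
      exact ⟨w + w', by simp, fun a ha => by
        rw [smul_add]; exact Λ.add_mem (hw a ha) (hw' a ha)⟩
  obtain ⟨w, hw1, hw⟩ := key 1 (by
    rw [mul_inv_cancel₀ hA0]; exact FractionalIdeal.one_mem_one _)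
  refine ⟨w, u, A, B, hw1, hfu, hu0, hA0, hB0, hA, fun v => ⟨fun hv => ?_, ?_⟩⟩
  · have hfv : f v ∈ A := (hA _).mpr ⟨v, hv, rfl⟩
    obtain ⟨b, hb⟩ := hu ⟨v - f v • w, by simp [hw1]⟩
    replace hb : b • u = v - f v • w := congrArg Subtype.val hb
    refine ⟨f v, hfv, b, (hB b).mpr ?_, by rw [hb]; abel⟩
    rw [hb]
    exact Λ.sub_mem hv (hw _ hfv)
  · rintro ⟨a, ha, b, hb, rfl⟩
    exact Λ.add_mem (hw a ha) ((hB b).mp hb)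

/-- Steinitz: a rank two lattice over a Dedekind domain is the sum of a free module of rank one
and a fractional ideal. -/
lemma exists_eq_free_add_fractionalIdeal [IsDedekindDomain R] (hW : finrank K W = 2)
    (Λ : Submodule R W) (hfg : Λ.FG) (hspan : Submodule.span K (Λ : Set W) = ⊤) :
    ∃ (e₁ e₂ : W) (B : FractionalIdeal R⁰ K), B ≠ 0 ∧
      ∀ v, v ∈ Λ ↔ ∃ a : R, ∃ b ∈ B, v = algebraMap R K a • e₁ + b • e₂ := by
  have : FiniteDimensional K W := .of_finrank_pos (by omega)
  have : Nontrivial W := nontrivial_of_finrank_pos (R := K) (by omega)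
  have exists_dual : ∀ u : W, u ≠ 0 → ∃ h : W →ₗ[K] K, h u = 1 := fun u hu => by
    obtain ⟨h, hh⟩ := not_forall.mp (mt (forall_dual_apply_eq_zero_iff K u).mp hu)
    exact ⟨(h u)⁻¹ • h, by simp [hh]⟩
  obtain ⟨x, hx⟩ := exists_ne (0 : W)
  obtain ⟨f, hf⟩ := exists_dual x hx
  obtain ⟨w, u, A, B, hfw, hfu, hu, hA0, hB0, -, hΛ⟩ := exists_split_of_functional hW Λ hfg hspan f
    (by rintro rfl; simp at hf)
  obtain ⟨h, hh⟩ := exists_dual u hu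
  obtain ⟨α, hα, hαA⟩ : ∃ α : K, α ≠ 0 ∧ FractionalIdeal.spanSingleton R⁰ α * A ≤ 1 := by
    obtain ⟨r, I, hr, hI⟩ := FractionalIdeal.exists_eq_spanSingleton_mul A
    have hr' : algebraMap R K r ≠ 0 := (FaithfulSMul.algebraMap_eq_zero_iff R K).not.mpr hr
    refine ⟨algebraMap R K r, hr', ?_⟩
    rw [hI, ← mul_assoc, FractionalIdeal.spanSingleton_mul_spanSingleton, mul_inv_cancel₀ hr',
      FractionalIdeal.spanSingleton_one, one_mul]
    exact FractionalIdeal.coeIdeal_le_one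
  obtain ⟨β, hβ⟩ := IsDedekindDomain.exists_add_spanSingleton_mul_eq hαA
    (mul_ne_zero (FractionalIdeal.spanSingleton_ne_zero_iff.mpr hα) hA0) hB0
  let g : W →ₗ[K] K := (α - β * h w) • f + β • h
  have hgw : g w = α := by simp [g, hfw]
  have hgu : g u = β := by simp [g, hfu, hh]
  obtain ⟨e₁, e₂, A', B', -, -, -, -, hB', hA', hΛ'⟩ :=
    exists_split_of_functional hW Λ hfg hspan g (by rintro h0; simp [h0, hα.symm] at hgw)
  have : A' = 1 := by
    ext a
    rw [hA', ← hβ, FractionalIdeal.mem_add]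
    simp only [FractionalIdeal.mem_singleton_mul]
    constructor
    · rintro ⟨v, hv, rfl⟩
      obtain ⟨a, ha, b, hb, rfl⟩ := (hΛ v).mp hv
      exact ⟨_, ⟨a, ha, rfl⟩, _, ⟨b, hb, rfl⟩, by simp [hgw, hgu, mul_comm]⟩
    · rintro ⟨_, ⟨a, ha, rfl⟩, _, ⟨b, hb, rfl⟩, rfl⟩
      exact ⟨_, (hΛ _).mpr ⟨a, ha, b, hb, rfl⟩, by simp [hgw, hgu, mul_comm]⟩
  refine ⟨e₁, e₂, B', hB', fun v => ?_⟩
  rw [hΛ', this]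
  simp [FractionalIdeal.mem_one_iff]

end Steinitz

section RealEmbeddings
open Module

variable {L : Type*} [Field L] [NumberField L]

/-- A totally real ring of integers is a full lattice in its Minkowski space. -/
lemma exists_basis_realEmbeddings (hTR : ∀ (σ : L →+* ℂ) (x : L), (σ x).im = 0) :
    ∃ b : Basis (Free.ChooseBasisIndex ℤ (𝓞 L)) ℝ ((L →+* ℝ) → ℝ),
      ∀ i σ, b i σ = σ (integralBasis L i) := by
  let down (τ : L →+* ℂ) : L →+* ℝ :=
    { toFun := fun x => (τ x).re
      map_one' := by simp
      map_zero' := by simp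
      map_add' := by simp
      map_mul' := by simp [hTR] }
  have hdown : ∀ τ x, ((down τ x : ℝ) : ℂ) = τ x := fun τ x =>
    Complex.ext rfl (by simp [hTR])
  let e : (L →+* ℝ) ≃ (L →+* ℂ) :=
    { toFun := fun σ => Complex.ofRealHom.comp σ
      invFun := down
      left_inv := fun σ => by ext x; simp [down]
      right_inv := fun τ => by ext x; simpa using hdown τ x }
  have := Fintype.ofFinite (L →+* ℝ)
  let v : Free.ChooseBasisIndex ℤ (𝓞 L) → (L →+* ℝ) → ℝ := fun i σ => σ (integralBasis L i)
  have hv : LinearIndependent ℝ v := by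
    rw [Fintype.linearIndependent_iff]
    intro c hc
    have hli := Fintype.linearIndependent_iff.mp
      (canonicalEmbedding.latticeBasis L).linearIndependent (fun i => (c i : ℂ)) (by
        ext τ
        have := congrArg (Complex.ofReal) (congrFun hc (down τ))
        simpa [v, hdown, canonicalEmbedding.apply_at] using this)
    exact fun i => by simpa using hli i
  have hcard : Fintype.card (Free.ChooseBasisIndex ℤ (𝓞 L)) = finrank ℝ ((L →+* ℝ) → ℝ) := by
    rw [finrank_fintype_fun_eq_card, Fintype.card_congr e, Embeddings.card,
      finrank_eq_card_basis (integralBasis L)]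
  have : Nonempty (Free.ChooseBasisIndex ℤ (𝓞 L)) := (integralBasis L).index_nonempty
  exact ⟨basisOfLinearIndependentOfCardEqFinrank hv hcard, fun i σ => by simp [v]⟩

/-- Elements of a totally real field realise all sign patterns. -/
lemma exists_forall_mul_pos (hTR : ∀ (σ : L →+* ℂ) (x : L), (σ x).im = 0)
    (ε : (L →+* ℝ) → ℝ) (hε : ∀ σ, ε σ ≠ 0) : ∃ x : L, ∀ σ : L →+* ℝ, 0 < σ x * ε σ := by
  obtain ⟨b, hb⟩ := exists_basis_realEmbeddings hTR
  have hdense : DenseRange fun c : Free.ChooseBasisIndex ℤ (𝓞 L) → ℚ =>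
      b.equivFun.symm fun i => (c i : ℝ) := by
    refine DenseRange.comp (g := b.equivFun.symm) (f := Pi.map fun _ (q : ℚ) => (q : ℝ))
      b.equivFun.symm.surjective.denseRange (DenseRange.piMap fun _ => Rat.denseRange_cast) ?_
    exact LinearMap.continuous_of_finiteDimensional b.equivFun.symm.toLinearMap
  have hopen : IsOpen {f : (L →+* ℝ) → ℝ | ∀ σ, 0 < f σ * ε σ} := by
    simp only [Set.ofPred_forall]
    exact isOpen_iInter_of_finite fun σ => isOpen_lt (by fun_prop) (by fun_prop)
  obtain ⟨c, hc⟩ := hdense.exists_mem_open hopen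
    ⟨ε, fun σ => mul_self_pos.mpr (hε σ)⟩
  refine ⟨∑ i, c i • integralBasis L i, fun σ => ?_⟩
  simpa [Basis.equivFun_symm_apply, hb, Rat.smul_def] using hc σ

/-- An action of the ring of integers of a totally real field on a real algebra extends to its
Minkowski space. -/
lemma exists_algHom_extension (hTR : ∀ (σ : L →+* ℂ) (x : L), (σ x).im = 0)
    {A : Type*} [Ring A] [Algebra ℝ A] (θ : 𝓞 L →+* A) :
    ∃ S : ((L →+* ℝ) → ℝ) →ₐ[ℝ] A, ∀ x : 𝓞 L, S (fun σ => σ (algebraMap (𝓞 L) L x)) = θ x := by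
  obtain ⟨b, hb⟩ := exists_basis_realEmbeddings hTR
  let S := b.constr ℝ fun i => θ (RingOfIntegers.basis L i)
  let ρ : 𝓞 L →+* ((L →+* ℝ) → ℝ) := RingHom.pi fun σ => σ.comp (algebraMap (𝓞 L) L)
  have hbρ : ∀ i, b i = ρ (RingOfIntegers.basis L i) := fun i => by
    ext σ; simp [hb, ρ, integralBasis_apply]
  have hS : ∀ x, S (ρ x) = θ x := fun x => by
    have : (S.toAddMonoidHom.comp ρ.toAddMonoidHom).toIntLinearMap =
        θ.toAddMonoidHom.toIntLinearMap :=
      (RingOfIntegers.basis L).ext fun i => by simp [← hbρ, S]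
    exact LinearMap.congr_fun this x
  have hmul : ∀ f g, S (f * g) = S f * S g := by
    have : (LinearMap.mul ℝ _).compr₂ S = (LinearMap.mul ℝ A).compl₁₂ S S :=
      b.ext fun i => b.ext fun j => by simp [hbρ, ← map_mul, hS]
    exact fun f g => LinearMap.congr_fun₂ this f g
  exact ⟨AlgHom.ofLinearMap S (by rw [← map_one ρ, hS, map_one]) hmul, hS⟩

end RealEmbeddings

section NumberFieldLattice

open Module nonZeroDivisors

variable {L : Type*} [Field L] [NumberField L]

/-- The rank over `ℤ` of a lattice spanning an `L`-vector space. -/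
lemma finrank_int_eq_mul_finrank {W : Type*} [AddCommGroup W] [Module L W] [Module (𝓞 L) W]
    [IsScalarTower (𝓞 L) L W] (Λ : Submodule (𝓞 L) W)
    (hspan : Submodule.span L (Λ : Set W) = ⊤) :
    finrank ℤ Λ = finrank ℚ L * finrank L W := by
  let _ : Module ℚ W := Module.compHom W (algebraMap ℚ L)
  have : IsScalarTower ℚ L W := ⟨fun q x w => by
    rw [Algebra.smul_def, mul_smul]; rfl⟩
  have hloc : IsLocalizedModule ℤ⁰ (Λ.subtype.restrictScalars ℤ) := by
    refine ⟨fun n => ?_, fun w => ?_, fun {x y} h => ⟨1, by rw [Subtype.ext h]⟩⟩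
    · have hn : ((n : ℤ) : ℚ) ≠ 0 := by exact_mod_cast nonZeroDivisors.coe_ne_zero n
      rw [Module.End.isUnit_iff]
      refine ⟨fun x y h => ?_, fun y => ⟨((n : ℤ) : ℚ)⁻¹ • y, ?_⟩⟩
      · simp only [Module.algebraMap_end_apply, ← Int.cast_smul_eq_zsmul ℚ] at h
        exact smul_right_injective W hn h
      · simp only [Module.algebraMap_end_apply, ← Int.cast_smul_eq_zsmul ℚ]
        exact smul_inv_smul₀ hn y
    · obtain ⟨r, hr, hrw⟩ := exists_smul_mem_of_mem_span (K := L) Λ (w := w) (by simp [hspan])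
      have hN : Ideal.absNorm (Ideal.span {r}) ≠ 0 := by
        simpa [Ideal.absNorm_eq_zero_iff] using hr
      obtain ⟨s, hs⟩ := Ideal.mem_span_singleton'.mp (Ideal.absNorm_mem (Ideal.span {r}))
      refine ⟨⟨⟨s • r • w, Λ.smul_mem s hrw⟩, ⟨(Ideal.absNorm (Ideal.span {r}) : ℤ),
        mem_nonZeroDivisors_of_ne_zero (by exact_mod_cast hN)⟩⟩, ?_⟩
      change (Ideal.absNorm (Ideal.span {r}) : ℤ) • w = s • r • w
      rw [smul_smul, hs, natCast_zsmul, Nat.cast_smul_eq_nsmul]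
  rw [Module.finrank_mul_finrank, IsFractionRing.finrank_right_eq ℤ (S := ℚ),
    IsLocalizedModule.finrank_eq ℤ⁰ (Λ.subtype.restrictScalars ℤ) le_rfl]

/-- Rank two lattices in an arbitrary `L`-vector space have a Steinitz decomposition. -/
lemma exists_eq_free_add_fractionalIdeal_of_finrank_int {V : Type*} [AddCommGroup V] [Module L V]
    [Module (𝓞 L) V] [IsScalarTower (𝓞 L) L V] (Λ : Submodule (𝓞 L) V) (hfg : Λ.FG)
    (hrank : finrank ℤ Λ = 2 * finrank ℚ L) :
    ∃ (e₁ e₂ : V) (B : FractionalIdeal (𝓞 L)⁰ L), B ≠ 0 ∧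
      ∀ v, v ∈ Λ ↔ ∃ a : 𝓞 L, ∃ b ∈ B, v = algebraMap (𝓞 L) L a • e₁ + b • e₂ := by
  let W := Submodule.span L (Λ : Set V)
  let i : W →ₗ[𝓞 L] V := W.subtype.restrictScalars (𝓞 L)
  have hi : Function.Injective i := Subtype.val_injective
  have hle : Λ ≤ LinearMap.range i := fun v hv => ⟨⟨v, Submodule.subset_span hv⟩, rfl⟩
  let Λ' : Submodule (𝓞 L) W := Λ.comap i
  have hmap : Λ'.map i = Λ := Submodule.map_comap_eq_of_le hle
  have hfg' : Λ'.FG := Submodule.fg_of_fg_map_injective i hi (by rwa [hmap])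
  have hspan : Submodule.span L (Λ' : Set W) = ⊤ := by
    exact Submodule.span_span_coe_preimage
  have hrank' : finrank ℤ Λ' = 2 * finrank ℚ L := by
    rw [← hrank, ← hmap]
    exact ((Submodule.equivMapOfInjective i hi Λ').restrictScalars ℤ).finrank_eq
  have hW : finrank L W = 2 := by
    rw [finrank_int_eq_mul_finrank Λ' hspan, mul_comm] at hrank'
    exact Nat.eq_of_mul_eq_mul_right finrank_pos hrank'
  obtain ⟨e₁, e₂, B, hB, h⟩ := exists_eq_free_add_fractionalIdeal hW Λ' hfg' hspan
  refine ⟨e₁, e₂, B, hB, fun v => ⟨fun hv => ?_, ?_⟩⟩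
  · obtain ⟨a, b, hb, hab⟩ := (h ⟨v, Submodule.subset_span hv⟩).mp hv
    exact ⟨a, b, hb, congrArg Subtype.val hab⟩
  · rintro ⟨a, b, hb, rfl⟩
    exact (h (algebraMap (𝓞 L) L a • e₁ + b • e₂)).mpr ⟨a, b, hb, rfl⟩

end NumberFieldLattice

section Uniformisation

open Module

variable {ι V : Type*} [Fintype ι] [AddCommGroup V] [Module ℂ V] [FiniteDimensional ℂ V]

/-- If `V` is generated over `ℝ^ι` by two vectors `e₁`, `e₂` and has dimension `|ι|`, then it is
isomorphic to `ℂ^ι`, with `e₂` going to `1` and `e₁` to a vector of non-real coordinates. -/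
lemma exists_linearEquiv_pi_of_generators (hdim : finrank ℂ V = Fintype.card ι)
    (S : (ι → ℝ) →ₐ[ℝ] Module.End ℂ V) (e₁ e₂ : V)
    (hgen : ∀ v, ∃ f g, v = S f e₁ + S g e₂) :
    ∃ φ : V ≃ₗ[ℂ] (ι → ℂ), (∀ f v i, φ (S f v) i = f i * φ v i) ∧
      φ e₂ = 1 ∧ ∀ i, (φ e₁ i).im ≠ 0 := by
  classical
  let F : ((ι → ℝ) × (ι → ℝ)) →ₗ[ℝ] V :=
    LinearMap.coprod ((LinearMap.applyₗ' ℝ e₁ : Module.End ℂ V →ₗ[ℝ] V) ∘ₗ S.toLinearMap)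
      ((LinearMap.applyₗ' ℝ e₂ : Module.End ℂ V →ₗ[ℝ] V) ∘ₗ S.toLinearMap)
  have hF : ∀ f g, F (f, g) = S f e₁ + S g e₂ := fun f g => by simp [F]
  have hsurj : Function.Surjective F := fun v => by
    obtain ⟨f, g, h⟩ := hgen v
    exact ⟨(f, g), by rw [hF, h]⟩
  have hinj : Function.Injective F := by
    have : FiniteDimensional ℝ V := FiniteDimensional.complexToReal V
    refine (LinearMap.injective_iff_surjective_of_finrank_eq_finrank ?_).mpr hsurj
    rw [finrank_prod, finrank_fintype_fun_eq_card, finrank_real_of_complex, hdim, two_mul]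
  have hF0 : ∀ f g, S f e₁ + S g e₂ = 0 → f = 0 ∧ g = 0 := fun f g h => by
    have : F (f, g) = F 0 := by rw [hF, h, map_zero]
    simpa using hinj this
  let p : ι → Module.End ℂ V := fun i => S (Pi.single i 1)
  have hSp : ∀ f i v, S f (p i v) = (f i : ℂ) • p i v := fun f i v => by
    have : f * Pi.single i 1 = f i • Pi.single i (1 : ℝ) := by
      ext j
      by_cases h : j = i
      · subst h; simp
      · simp [h]
    rw [← Module.End.mul_apply, ← map_mul, this, map_smul]
    rfl
  let Ψ : (ι → ℂ) →ₗ[ℂ] V := Fintype.linearCombination ℂ fun i => p i e₂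
  have hΨ : ∀ f, Ψ f = ∑ i, f i • p i e₂ := fun f => Fintype.linearCombination_apply ..
  have hpΨ : ∀ f j, p j (Ψ f) = f j • p j e₂ := fun f j => by
    have : ∀ i, p j (p i e₂) = if i = j then p j e₂ else 0 := fun i => by
      rw [hSp]
      by_cases h : i = j
      · subst h; simp
      · simp [h]
    simp [hΨ, this]
  have hΨinj : Function.Injective Ψ := by
    rw [← LinearMap.ker_eq_bot, LinearMap.ker_eq_bot']
    intro f hf
    ext j
    have h := hpΨ f j
    rw [hf, map_zero, eq_comm, smul_eq_zero] at h
    refine h.resolve_right fun h0 => ?_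
    have := congrFun (hF0 0 (Pi.single j 1) (by simpa [p] using h0)).2 j
    simp at this
  let φ : (ι → ℂ) ≃ₗ[ℂ] V := LinearEquiv.ofInjectiveOfFinrankEq Ψ hΨinj (by
    rw [finrank_fintype_fun_eq_card, hdim])
  have hφ : ∀ f, φ f = Ψ f := fun f => rfl
  have hSφ : ∀ (f : ι → ℝ) g, S f (φ g) = φ (fun i => f i * g i) := fun f g => by
    simp only [hφ, hΨ, map_sum, map_smul, hSp, smul_smul, mul_comm]
  have hφ1 : φ 1 = e₂ := by
    have h1 : ∑ i, (Pi.single i 1 : ι → ℝ) = 1 := Finset.univ_sum_single 1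
    calc φ 1 = (∑ i, p i) e₂ := by simp [hφ, hΨ]
      _ = e₂ := by rw [← map_sum, h1, map_one]; rfl
  refine ⟨φ.symm, fun f v i => ?_, ?_, fun i him => ?_⟩
  · obtain ⟨g, rfl⟩ := φ.surjective v
    rw [hSφ]; simp
  · rw [← hφ1]; simp
  · set x := (φ.symm e₁ i).re with hx
    have hz : φ.symm e₁ i = x := Complex.ext (by simp [hx]) (by simp [him])
    have h := hpΨ (φ.symm e₁) i
    rw [← hφ, LinearEquiv.apply_symm_apply, hz] at h
    have h' : S (Pi.single i 1) e₁ + S ((-x) • Pi.single i 1) e₂ = 0 := by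
      rw [map_smul]
      change p i e₁ + ((-x : ℝ) : ℂ) • p i e₂ = 0
      rw [h]
      simp
    simpa using congrFun (hF0 _ _ h').1 i

end Uniformisation

theorem lattice_with_real_multiplication_standard_form
    (L : Type*) [Field L] [NumberField L]
    (hTR : ∀ (σ : L →+* ℂ) (x : L), (σ x).im = 0)
    (V : Type*) [AddCommGroup V] [Module ℂ V] [FiniteDimensional ℂ V]
    (hdim : Module.finrank ℂ V = Module.finrank ℚ L)
    (Λ : Submodule ℤ V) (hΛ : IsLattice V Λ)
    (θ : (𝓞 L) →+* Module.End ℂ V)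
    (hθ : ∀ (x : 𝓞 L), ∀ v ∈ Λ, θ x v ∈ Λ) :
    ∃ (z : (L →+* ℝ) → ℂ) (B : FractionalIdeal (nonZeroDivisors (𝓞 L)) L)
      (φ : V ≃ₗ[ℂ] ((L →+* ℝ) → ℂ)),
      (∀ σ : L →+* ℝ, 0 < (z σ).im) ∧
      B ≠ 0 ∧
      φ '' (Λ : Set V) =
        {f : (L →+* ℝ) → ℂ | ∃ (a : 𝓞 L), ∃ b ∈ B,
          f = fun σ => (σ (algebraMap (𝓞 L) L a) : ℂ) * z σ + (σ b : ℂ)} := by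
  obtain ⟨hfg, hrank, hspan⟩ := hΛ
  rw [hdim] at hrank
  obtain ⟨S, hS⟩ := exists_algHom_extension hTR θ
  let ρ : L →+* ((L →+* ℝ) → ℝ) := RingHom.pi fun σ => σ
  let T : L →+* Module.End ℂ V := S.toRingHom.comp ρ
  let _ : Module L V := Module.compHom V T
  let _ : Module (𝓞 L) V := Module.compHom V (algebraMap (𝓞 L) L)
  have : IsScalarTower (𝓞 L) L V := ⟨fun r x v => by
    rw [Algebra.smul_def, mul_smul]; rfl⟩
  have hLV : ∀ (x : L) (v : V), x • v = S (ρ x) v := fun _ _ => rfl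
  let Λ' : Submodule (𝓞 L) V :=
    { Λ.toAddSubmonoid with
      smul_mem' := fun r v hv => by
        have h : r • v = θ r v := by rw [← hS]; rfl
        rw [h]
        exact hθ r v hv }
  have hfg' : Λ'.FG := Submodule.FG.of_restrictScalars ℤ hfg
  obtain ⟨e₁, e₂, B, hB, hmem⟩ :=
    exists_eq_free_add_fractionalIdeal_of_finrank_int Λ' hfg' hrank
  simp only [hLV] at hmem
  have hgen : ∀ v, ∃ f g, v = S f e₁ + S g e₂ := fun v => by
    have hv : v ∈ Submodule.span ℝ (Λ : Set V) := by simp [hspan]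
    induction hv using Submodule.span_induction with
    | mem x hx =>
      obtain ⟨a, b, -, h⟩ := (hmem x).mp hx
      exact ⟨_, _, h⟩
    | zero => exact ⟨0, 0, by simp⟩
    | add x y _ _ hx hy =>
      obtain ⟨f, g, rfl⟩ := hx
      obtain ⟨f', g', rfl⟩ := hy
      exact ⟨f + f', g + g', by simp only [map_add, LinearMap.add_apply]; abel⟩
    | smul c x _ hx =>
      obtain ⟨f, g, rfl⟩ := hx
      exact ⟨c • f, c • g, by simp only [map_smul, LinearMap.smul_apply, smul_add]⟩
  obtain ⟨b₀, -⟩ := exists_basis_realEmbeddings hTR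
  have := Fintype.ofFinite (L →+* ℝ)
  have hcard : Module.finrank ℂ V = Fintype.card (L →+* ℝ) := by
    rw [hdim, ← RingOfIntegers.rank, Module.finrank_eq_card_chooseBasisIndex,
      ← Module.finrank_eq_card_basis b₀, Module.finrank_fintype_fun_eq_card]
  obtain ⟨φ, hφS, hφ₂, him⟩ := exists_linearEquiv_pi_of_generators hcard S e₁ e₂ hgen
  obtain ⟨x, hx⟩ := exists_forall_mul_pos hTR (fun σ => (φ e₁ σ).im) him
  have hx0 : ∀ σ : L →+* ℝ, σ x ≠ 0 := fun σ h => by simpa [h] using hx σ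
  have hxL : x ≠ 0 := by
    obtain ⟨σ⟩ : Nonempty (L →+* ℝ) := Fintype.card_pos_iff.mp (by
      rw [← hcard, hdim]; exact Module.finrank_pos)
    rintro rfl
    exact hx0 σ (map_zero σ)
  let scale : ((L →+* ℝ) → ℂ) ≃ₗ[ℂ] ((L →+* ℝ) → ℂ) :=
    LinearEquiv.piCongrRight fun σ => LinearEquiv.smulOfNeZero ℂ ℂ ((σ x : ℝ) : ℂ)
      (by exact_mod_cast hx0 σ)
  have hscale : ∀ f σ, scale f σ = σ x * f σ := fun _ _ => rfl
  refine ⟨scale (φ e₁), FractionalIdeal.spanSingleton _ x * B, φ.trans scale, fun σ => ?_,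
    mul_ne_zero (FractionalIdeal.spanSingleton_ne_zero_iff.mpr hxL) hB, ?_⟩
  · rw [hscale, Complex.im_ofReal_mul]
    exact hx σ
  · have hcoord : ∀ a b, φ.trans scale (S (ρ a) e₁ + S (ρ b) e₂) =
        fun σ => (σ a : ℂ) * scale (φ e₁) σ + (σ (x * b) : ℂ) := fun a b => by
      ext σ
      simp only [LinearEquiv.trans_apply, hscale, map_add, Pi.add_apply, hφS, hφ₂, Pi.one_apply,
        map_mul, Complex.ofReal_mul]
      simp only [ρ, RingHom.pi_apply]
      ring
    ext f
    simp only [Set.mem_image, Set.mem_ofPred_eq, FractionalIdeal.mem_singleton_mul]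
    constructor
    · rintro ⟨v, hv, rfl⟩
      obtain ⟨a, b, hb, rfl⟩ := (hmem v).mp hv
      exact ⟨a, _, ⟨b, hb, rfl⟩, hcoord _ b⟩
    · rintro ⟨a, _, ⟨b, hb, rfl⟩, rfl⟩
      exact ⟨_, (hmem _).mpr ⟨a, b, hb, rfl⟩, hcoord _ b⟩
end

section
/- Let R be a Dedekind domain with fraction field K, and let M be a finitely generated torsion-free R-module of rank n ≥ 1, where n = dim_K (M ⊗_R K). Then there exists a nonzero fractional ideal 𝔄 of R such that M is isomorphic as an R-module to R^{n−1} ⊕ 𝔄. -/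
open Module

section Domain

variable {R M N : Type*} [CommRing R] [AddCommGroup M] [Module R M] [AddCommGroup N] [Module R N]

/-- A surjection onto a projective module splits off its kernel as a direct factor. -/
theorem LinearMap.nonempty_equiv_ker_prod_of_surjective [Projective R N] (f : M →ₗ[R] N)
    (hf : Function.Surjective f) : Nonempty (M ≃ₗ[R] LinearMap.ker f × N) := by
  obtain ⟨s, hs⟩ := projective_lifting_property f LinearMap.id hf
  have hex : Function.Exact (LinearMap.ker f).subtype f := LinearMap.exact_subtype_ker_map f
  exact ⟨(hex.splitSurjectiveEquiv (Submodule.injective_subtype _) ⟨s, hs⟩).1⟩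

variable [IsDomain R]

theorem Ideal.finrank_eq_one_of_ne_bot [IsNoetherianRing R] {I : Ideal R} (hI : I ≠ ⊥) :
    finrank R I = 1 := by
  have : Nontrivial I := Submodule.nontrivial_iff_ne_bot.mpr hI
  have hpos : 0 < finrank R I := finrank_pos
  have hle : finrank R I ≤ finrank R R := Submodule.finrank_le I
  rw [finrank_self] at hle
  omega

theorem LinearMap.finrank_ker_add_one_of_ne_zero [IsNoetherianRing R] [Module.Finite R M]
    {f : M →ₗ[R] R} (hf : f ≠ 0) : finrank R (LinearMap.ker f) + 1 = finrank R M := by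
  have hrange : finrank R (LinearMap.range f) = 1 :=
    Ideal.finrank_eq_one_of_ne_bot (mt LinearMap.range_eq_bot.mp hf)
  rw [← Submodule.finrank_quotient_add_finrank (LinearMap.ker f),
    f.quotKerEquivRange.finrank_eq, hrange, add_comm]

/-- A nonzero linear functional on a finitely generated torsion-free module of rank one is
injective. -/
theorem LinearMap.injective_of_finrank_eq_one [IsNoetherianRing R] [Module.Finite R M]
    [IsTorsionFree R M] {f : M →ₗ[R] R} (hf : f ≠ 0) (hM : finrank R M = 1) :
    Function.Injective f := by
  have hker : finrank R (LinearMap.ker f) = 0 := by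
    have := LinearMap.finrank_ker_add_one_of_ne_zero hf
    omega
  rw [← LinearMap.ker_eq_bot, ← not_not (a := LinearMap.ker f = ⊥), ← ne_eq,
    ← Submodule.nontrivial_iff_ne_bot, ← finrank_pos_iff (R := R)]
  omega

end Domain

section Dedekind

variable {R : Type*} [CommRing R] [IsDedekindDomain R]

theorem IsDedekindDomain.projective_of_isTorsionFree (M : Type*) [AddCommGroup M] [Module R M]
    [Module.Finite R M] [IsTorsionFree R M] : Projective R M :=
  have := Module.finitePresentation_of_finite R M
  Module.Flat.projective_of_finitePresentation

theorem IsDedekindDomain.exists_dual_ne_zero (M : Type*) [AddCommGroup M] [Module R M]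
    [Module.Finite R M] [IsTorsionFree R M] [Nontrivial M] : ∃ f : M →ₗ[R] R, f ≠ 0 := by
  have := IsDedekindDomain.projective_of_isTorsionFree (R := R) M
  obtain ⟨m, hm⟩ := exists_ne (0 : M)
  by_contra! h
  exact hm ((forall_dual_apply_eq_zero_iff R m).mp fun φ ↦ by rw [h φ, LinearMap.zero_apply])

/-- For nonzero ideals `I` and `J` of a Dedekind domain, some functional on `I` has image
coprime to `J`. -/
theorem IsDedekindDomain.exists_dual_range_sup_eq_top {I J : Ideal R} (hI : I ≠ ⊥) (hJ : J ≠ ⊥) :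
    ∃ f : I →ₗ[R] R, LinearMap.range f ⊔ J = ⊤ := by
  obtain ⟨c, hcI, hc⟩ := Submodule.exists_mem_ne_zero_of_ne_bot hI
  obtain ⟨I', hI'⟩ := Ideal.dvd_span_singleton.mpr hcI
  have hI'0 : I' ≠ ⊥ := by
    rintro rfl
    simp [hc] at hI'
  obtain ⟨a, ha⟩ := IsDedekindDomain.exists_sup_span_eq
    (Ideal.mul_le_right : J * I' ≤ I') (mul_ne_zero hJ hI'0)
  have haI' : a ∈ I' := ha ▸ Ideal.mem_sup_right (Ideal.mem_span_singleton_self a)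
  have hdvd (i : I) : ∃ r, a * i = c * r := by
    refine Ideal.mem_span_singleton.mp ?_
    rw [hI', mul_comm a]
    exact Ideal.mul_mem_mul i.2 haI'
  choose g hg using hdvd
  let f : I →ₗ[R] R :=
    { toFun := g
      map_add' := fun x y ↦ mul_left_cancel₀ hc <| by
        rw [← hg, mul_add, ← hg, ← hg, Submodule.coe_add, mul_add]
      map_smul' := fun r x ↦ mul_left_cancel₀ hc <| by
        rw [← hg, RingHom.id_apply, smul_eq_mul, mul_left_comm, ← hg, Submodule.coe_smul,
          smul_eq_mul, mul_left_comm] }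
  refine ⟨f, (Ideal.eq_top_iff_one _).mpr ?_⟩
  have hle : Ideal.span {c} ≤ Ideal.span {c} * (LinearMap.range f ⊔ J) := by
    calc Ideal.span {c} = I * (J * I' ⊔ Ideal.span {a}) := by rw [ha, hI']
      _ = Ideal.span {c} * J ⊔ I * Ideal.span {a} := by
        rw [Ideal.mul_sup, hI', mul_left_comm, mul_comm J]
      _ ≤ _ := by
        refine sup_le (Ideal.mul_mono_right le_sup_right) fun x hx ↦ ?_
        obtain ⟨i, hi, rfl⟩ := Ideal.mem_mul_span_singleton.mp hx
        rw [mul_comm i, hg ⟨i, hi⟩]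
        exact Ideal.mul_mem_mul (Ideal.mem_span_singleton_self c)
          (Ideal.mem_sup_left (LinearMap.mem_range_self f ⟨i, hi⟩))
  obtain ⟨z, hz, hcz⟩ :=
    Ideal.mem_span_singleton_mul.mp (hle (Ideal.mem_span_singleton_self c))
  rwa [mul_left_cancel₀ hc (hcz.trans (mul_one c).symm)] at hz

/-- The sum of two nonzero ideals of a Dedekind domain has a free direct factor of rank one. -/
theorem IsDedekindDomain.exists_ideal_prod_equiv {I J : Ideal R} (hI : I ≠ ⊥) (hJ : J ≠ ⊥) :
    ∃ L : Ideal R, L ≠ ⊥ ∧ Nonempty ((I × J) ≃ₗ[R] R × L) := by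
  obtain ⟨f, hf⟩ := IsDedekindDomain.exists_dual_range_sup_eq_top hI hJ
  let g : I × J →ₗ[R] R := f.coprod J.subtype
  have hg : Function.Surjective g := by
    rw [← LinearMap.range_eq_top, LinearMap.range_coprod, Submodule.range_subtype]
    exact hf
  let p : LinearMap.ker g →ₗ[R] R :=
    I.subtype ∘ₗ LinearMap.fst R I J ∘ₗ (LinearMap.ker g).subtype
  have hp : Function.Injective p := by
    rintro ⟨⟨x, y⟩, hxy⟩ ⟨⟨x', y'⟩, hxy'⟩ h
    obtain rfl : x = x' := Subtype.ext h
    have hy : f x + y = 0 := hxy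
    have hy' : f x + y' = 0 := hxy'
    obtain rfl : y = y' := Subtype.ext (add_left_cancel (hy.trans hy'.symm))
    rfl
  obtain ⟨e⟩ := g.nonempty_equiv_ker_prod_of_surjective hg
  refine ⟨LinearMap.range p, fun h ↦ ?_, ⟨e ≪≫ₗ LinearEquiv.prodComm R _ _ ≪≫ₗ
    (LinearEquiv.refl R R).prodCongr (LinearEquiv.ofInjective p hp)⟩⟩
  obtain ⟨i, hi, hi0⟩ := Submodule.exists_mem_ne_zero_of_ne_bot hI
  obtain ⟨j, hj, hj0⟩ := Submodule.exists_mem_ne_zero_of_ne_bot hJ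
  let x : I := ⟨j * i, I.mul_mem_left j hi⟩
  let y : J := ⟨-(j * f ⟨i, hi⟩), J.neg_mem (J.mul_mem_right _ hj)⟩
  have hxy : (x, y) ∈ LinearMap.ker g := by
    have hx : f x = j * f ⟨i, hi⟩ := f.map_smul j ⟨i, hi⟩
    change f x + -(j * f ⟨i, hi⟩) = 0
    rw [hx, add_neg_cancel]
  have hpx : p ⟨(x, y), hxy⟩ = 0 := by
    rw [LinearMap.range_eq_bot.mp h, LinearMap.zero_apply]
  exact mul_ne_zero hj0 hi0 hpx

/-- **Steinitz's theorem**: a finitely generated torsion-free module of rank `n + 1` over a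
Dedekind domain is the direct sum of a free module of rank `n` and a nonzero ideal. -/
theorem IsDedekindDomain.exists_equiv_pi_prod_ideal (n : ℕ) (M : Type*) [AddCommGroup M]
    [Module R M] [Module.Finite R M] [IsTorsionFree R M] (hM : finrank R M = n + 1) :
    ∃ I : Ideal R, I ≠ ⊥ ∧ Nonempty (M ≃ₗ[R] (Fin n → R) × I) := by
  have : Nontrivial M := finrank_pos_iff (R := R).mp (by omega)
  obtain ⟨f, hf⟩ := IsDedekindDomain.exists_dual_ne_zero (R := R) M
  have hI : LinearMap.range f ≠ ⊥ := mt LinearMap.range_eq_bot.mp hf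
  induction n generalizing M with
  | zero =>
    exact ⟨LinearMap.range f, hI, ⟨LinearEquiv.ofInjective f
      (LinearMap.injective_of_finrank_eq_one hf hM) ≪≫ₗ LinearEquiv.uniqueProd.symm⟩⟩
  | succ n ih =>
    have hker := LinearMap.finrank_ker_add_one_of_ne_zero hf
    have : Nontrivial (LinearMap.ker f) := finrank_pos_iff (R := R).mp (by omega)
    obtain ⟨g, hg⟩ := IsDedekindDomain.exists_dual_ne_zero (R := R) (LinearMap.ker f)
    obtain ⟨J, hJ, ⟨eJ⟩⟩ := ih (LinearMap.ker f) (by omega) this g hg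
      (mt LinearMap.range_eq_bot.mp hg)
    obtain ⟨L, hL, ⟨eL⟩⟩ := IsDedekindDomain.exists_ideal_prod_equiv hJ hI
    have := IsDedekindDomain.projective_of_isTorsionFree (R := R) (LinearMap.range f)
    obtain ⟨e⟩ := f.rangeRestrict.nonempty_equiv_ker_prod_of_surjective f.surjective_rangeRestrict
    rw [LinearMap.ker_rangeRestrict] at e
    exact ⟨L, hL, ⟨e ≪≫ₗ eJ.prodCongr (LinearEquiv.refl R _) ≪≫ₗ
      LinearEquiv.prodAssoc R _ _ _ ≪≫ₗ (LinearEquiv.refl R _).prodCongr eL ≪≫ₗ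
      (LinearEquiv.prodAssoc R _ _ _).symm ≪≫ₗ
      (LinearEquiv.prodComm R _ _ ≪≫ₗ Fin.consLinearEquiv R fun _ ↦ R).prodCongr
        (LinearEquiv.refl R L)⟩⟩

end Dedekind

/-!
STATEMENT 13: Let R be a Dedekind domain with fraction field K and M a finitely generated
torsion-free R-module of rank n ≥ 1 (n = dim_K (M ⊗_R K)). Then there is a nonzero
fractional ideal 𝔄 of R with M ≅ R^{n-1} ⊕ 𝔄 as R-modules.
-/

theorem finitely_generated_torsionFree_iso_pow_prod_fractionalIdeal
    (R : Type*) [CommRing R] [IsDomain R] [IsDedekindDomain R]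
    (K : Type*) [Field K] [Algebra R K] [IsFractionRing R K]
    (M : Type*) [AddCommGroup M] [Module R M] [Module.Finite R M]
    (htf : ∀ (r : R) (m : M), r • m = 0 → r = 0 ∨ m = 0)
    (n : ℕ) (hn : 1 ≤ n)
    (hrank : Module.finrank K (TensorProduct R K M) = n) :
    ∃ A : FractionalIdeal (nonZeroDivisors R) K,
      A ≠ 0 ∧ Nonempty (M ≃ₗ[R] ((Fin (n - 1) → R) × A)) := by
  have : IsTorsionFree R M := .of_smul_eq_zero htf
  have hM : finrank R M = n - 1 + 1 := by
    rw [Nat.sub_add_cancel hn, ← hrank, (TensorProduct.isBaseChange R M K).finrank_eq]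
  obtain ⟨I, hI, ⟨e⟩⟩ := IsDedekindDomain.exists_equiv_pi_prod_ideal (n - 1) M hM
  exact ⟨I, FractionalIdeal.coeIdeal_ne_zero.mpr hI, ⟨e ≪≫ₗ (LinearEquiv.refl R _).prodCongr
    (I.equivMapOfInjective (Algebra.linearMap R K) (IsFractionRing.injective R K))⟩⟩
end
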